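/- arXiv:1706.06534 — 5 statements merged into one kernel-verified Lean document; each statement's English description precedes it below -/
import Mathlib

section
/- (Jouanolou's lemma.) Let F₁,…,F_m ∈ ℂ[x₀,…,xₙ] be irreducible homogeneous polynomials that are pairwise non-proportional (distinct modulo multiplicative constants). If λ₁,…,λ_m ∈ ℂ satisfy Σ_{i=1}^m λ_i F̂_i dF_i = 0 as a polynomial 1-form (equivalently Σ_i λ_i dF_i/F_i = 0 as a rational 1-form), then λ_i = 0 for all i. That is, the rational 1-forms dF₁/F₁, …, dF_m/F_m are linearly independent over ℂ. -/
open MvPolynomial Finset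

namespace LogStab

/-- The polynomial ring `ℂ[x₀, …, x_{N-1}]`. -/
abbrev S (N : ℕ) : Type := MvPolynomial (Fin N) ℂ

/-- A polynomial 1-form `∑ₖ aₖ dxₖ` on `ℂ^N`, given by its coefficients `aₖ`. -/
abbrev Form1 (N : ℕ) : Type := Fin N → S N

/-- The differential `dF` of a polynomial, as a 1-form. -/
noncomputable def Dp {N : ℕ} (F : S N) : Form1 N := fun k => pderiv k F

/-- Exterior derivative of a 1-form: the antisymmetric coefficients of the 2-form `dω`,
`(dω)_{kl} = ∂ₖ ω_l - ∂_l ω_k`. -/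
noncomputable def extD {N : ℕ} (ω : Form1 N) : Fin N → Fin N → S N :=
  fun k l => pderiv k (ω l) - pderiv l (ω k)

/-- Wedge of two 1-forms: `(α ∧ β)_{kl} = αₖ β_l - α_l βₖ`. -/
noncomputable def w11 {N : ℕ} (α β : Form1 N) : Fin N → Fin N → S N :=
  fun k l => α k * β l - α l * β k

/-- Wedge of a 1-form and an (antisymmetric) 2-form: coefficients of the 3-form. -/
noncomputable def w12 {N : ℕ} (α : Form1 N) (β : Fin N → Fin N → S N) :
    Fin N → Fin N → Fin N → S N :=
  fun i j k => α i * β j k - α j * β i k + α k * β i j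

/-- Wedge of two (antisymmetric) 2-forms: coefficients of the 4-form. -/
noncomputable def w22 {N : ℕ} (β γ : Fin N → Fin N → S N) :
    Fin N → Fin N → Fin N → Fin N → S N :=
  fun i j k l =>
    β i j * γ k l - β i k * γ j l + β i l * γ j k + β j k * γ i l - β j l * γ i k + β k l * γ i j

/-- Contraction `⟨R, α⟩ = ∑ₖ xₖ aₖ` of a 1-form with the radial (Euler) vector field. -/
noncomputable def radial {N : ℕ} (α : Form1 N) : S N := ∑ k, X k * α k

/-- `α` is a homogeneous 1-form of degree `d`:
all its coefficients are homogeneous polynomials of degree `d - 1`. -/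
def IsHomog1 {N : ℕ} (α : Form1 N) (d : ℕ) : Prop := ∀ k, (α k).IsHomogeneous (d - 1)

/-- `F̂ᵢ = ∏_{j ≠ i} F_j`. -/
noncomputable def Fhat {N m : ℕ} (F : Fin m → S N) (i : Fin m) : S N :=
  ∏ j ∈ Finset.univ.erase i, F j

/-- `F̂ᵢⱼ = ∏_{k ≠ i, j} F_k`. -/
noncomputable def Fhat2 {N m : ℕ} (F : Fin m → S N) (i j : Fin m) : S N :=
  ∏ k ∈ (Finset.univ.erase i).erase j, F k

/-- The logarithmic 1-form `ω = μ(λ, F) = ∑ᵢ λᵢ F̂ᵢ dFᵢ`. -/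
noncomputable def logForm {N m : ℕ} (lam : Fin m → ℂ) (F : Fin m → S N) : Form1 N :=
  fun k => ∑ i, C (lam i) * Fhat F i * pderiv k (F i)

/-- The condition `ω ∧ dα + α ∧ dω = 0` (as a 3-form). -/
def TangentZero {N : ℕ} (ω α : Form1 N) : Prop :=
  ∀ i j k, w12 ω (extD α) i j k + w12 α (extD ω) i j k = 0

/-- The derivative of the multilinear map `μ` at `(λ, F)` in the direction `(λ', F')`:
`∑ᵢ λ'ᵢ F̂ᵢ dFᵢ + ∑_{i ≠ k} λᵢ F'ₖ F̂ᵢₖ dFᵢ + ∑ᵢ λᵢ F̂ᵢ dF'ᵢ`. -/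
noncomputable def dmu {N m : ℕ} (lam : Fin m → ℂ) (F : Fin m → S N)
    (lam' : Fin m → ℂ) (F' : Fin m → S N) : Form1 N :=
  fun k =>
    (∑ i, C (lam' i) * Fhat F i * pderiv k (F i)) +
    (∑ i, ∑ j ∈ Finset.univ.erase i, C (lam i) * F' j * Fhat2 F i j * pderiv k (F i)) +
    (∑ i, C (lam i) * Fhat F i * pderiv k (F' i))

/-- The `Fᵢ` are in general position: each `Fᵢ` is irreducible and at every nonzero point
of the cone the differentials of the `Fᵢ` vanishing there are linearly independent
(simple normal crossings; in particular each hypersurface is smooth). -/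
def GeneralPosition {N m : ℕ} (F : Fin m → S N) : Prop :=
  (∀ i, Irreducible (F i)) ∧
  ∀ x : Fin N → ℂ, x ≠ 0 →
    LinearIndependent ℂ (fun i : {i : Fin m // eval x (F i) = 0} =>
      (fun k => eval x (pderiv k (F i.1)) : Fin N → ℂ))

/-- A polynomial function on a complex vector space: an element of the subalgebra of
functions generated by the linear functionals. -/
def IsPolyFun {E : Type*} [AddCommGroup E] [Module ℂ E] (f : E → ℂ) : Prop :=
  f ∈ Algebra.adjoin ℂ {g : E → ℂ | IsLinearMap ℂ g}

/-- The Zariski topology on a complex vector space, generated by the basic open sets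
`{x | f x ≠ 0}` for `f` a polynomial function; closed sets are the common zero loci
of families of polynomial functions. -/
def zariskiTop (E : Type*) [AddCommGroup E] [Module ℂ E] : TopologicalSpace E :=
  TopologicalSpace.generateFrom {U | ∃ f : E → ℂ, IsPolyFun f ∧ U = {x | f x ≠ 0}}

/-- A homogeneous irreducible polynomial over `ℂ` has positive degree. -/
theorem degree_ne_zero_of_irreducible {N d : ℕ} {F : S N} (hF : Irreducible F)
    (hd : F.IsHomogeneous d) : d ≠ 0 := by
  rintro rfl
  have hC : F = C (coeff 0 F) :=
    totalDegree_eq_zero_iff_eq_C.mp (hd.totalDegree hF.ne_zero)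
  refine hF.not_isUnit ?_
  rw [hC]
  refine (IsUnit.mk0 _ fun h0 => hF.ne_zero ?_).map C
  rw [hC, h0, C_0]

/-- A homogeneous irreducible polynomial over `ℂ` fails to divide one of its partial
derivatives. -/
theorem exists_not_dvd_pderiv {N d : ℕ} {F : S N} (hF : Irreducible F)
    (hd : F.IsHomogeneous d) : ∃ k, ¬ F ∣ pderiv k F := by
  have hd0 := degree_ne_zero_of_irreducible hF hd
  by_contra! hdvd
  have hpd : ∀ k, pderiv k F = 0 := by
    intro k
    by_contra hne
    have hle := totalDegree_le_of_dvd_of_isDomain (hdvd k) hne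
    rw [hd.totalDegree hF.ne_zero, hd.pderiv.totalDegree hne] at hle
    omega
  have euler := hd.sum_X_mul_pderiv
  simp only [hpd, mul_zero, Finset.sum_const_zero] at euler
  exact (smul_ne_zero hd0 hF.ne_zero) euler.symm

/-- Irreducible polynomials, one of which divides the other, are proportional. -/
theorem exists_eq_C_mul_of_dvd {N : ℕ} {F G : S N} (hF : Irreducible F) (hG : Irreducible G)
    (h : F ∣ G) : ∃ t : ℂ, G = C t * F := by
  obtain ⟨u, rfl⟩ := hF.associated_of_dvd hG h
  obtain ⟨t, -, ht⟩ := isUnit_iff_eq_C_of_isReduced.mp u.isUnit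
  exact ⟨t, by rw [ht, mul_comm]⟩

/-- Jouanolou's lemma: if the `Fᵢ` are irreducible homogeneous and pairwise
non-proportional and `∑ λᵢ F̂ᵢ dFᵢ = 0`, then all `λᵢ = 0`; that is, the rational
1-forms `dFᵢ/Fᵢ` are linearly independent over `ℂ`. -/
theorem statement5 (n m : ℕ) (dd : Fin m → ℕ) (lam : Fin m → ℂ)
    (F : Fin m → S (n+1))
    (hFirr : ∀ i, Irreducible (F i)) (hFh : ∀ i, (F i).IsHomogeneous (dd i))
    (hprop : ∀ i j, i ≠ j → ∀ t : ℂ, F i ≠ C t * F j)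
    (hzero : ∀ k, ∑ i, C (lam i) * Fhat F i * pderiv k (F i) = 0) :
    ∀ i, lam i = 0 := by
  intro i
  by_contra hi
  have hprime : Prime (F i) := (hFirr i).prime
  obtain ⟨k, hk⟩ := exists_not_dvd_pderiv (hFirr i) (hFh i)
  have hterm : F i ∣ C (lam i) * Fhat F i * pderiv k (F i) := by
    have hsum := hzero k
    rw [← Finset.add_sum_erase _ _ (Finset.mem_univ i)] at hsum
    rw [eq_neg_of_add_eq_zero_left hsum, dvd_neg]
    refine Finset.dvd_sum fun j hj => ?_
    have hmem : i ∈ Finset.univ.erase j :=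
      Finset.mem_erase.mpr ⟨(Finset.ne_of_mem_erase hj).symm, Finset.mem_univ i⟩
    exact ((Finset.dvd_prod_of_mem F hmem).mul_left _).mul_right _
  rcases hprime.dvd_or_dvd hterm with h | h
  · rcases hprime.dvd_or_dvd h with h | h
    · exact hprime.not_isUnit (isUnit_of_dvd_unit h ((IsUnit.mk0 _ hi).map C))
    · obtain ⟨j, hj, hdvd⟩ := (hprime.dvd_finsetProd_iff F).mp h
      obtain ⟨t, ht⟩ := exists_eq_C_mul_of_dvd (hFirr i) (hFirr j) hdvd
      exact hprop j i (Finset.ne_of_mem_erase hj) t ht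
  · exact hk h

end LogStab
end

section
/- (Description of the base locus.) Let λ ∈ ℂ^m be nonzero and let F₁,…,F_m ∈ ℂ[x₀,…,xₙ] be nonzero homogeneous polynomials of degrees d₁,…,d_m ≥ 1 such that Σ_{i=1}^m λ_i F̂_i dF_i = 0. Write each F_i (by unique factorization) as F_i = c_i ∏_{j=1}^{m'} G_j^{e_{ij}}, where c_i ∈ ℂ*, the G_j are pairwise non-proportional irreducible homogeneous polynomials of degrees d'_j, and e_{ij} ∈ ℕ. Then Σ_{i=1}^m λ_i e_{ij} = 0 for every j = 1, …, m' (and taking degrees, d_i = Σ_j e_{ij} d'_j). In other words, every point of the base locus of μ outside the trivial locus lies in some B_φ with φ = (m', e, 𝐝') a decomposition of 𝐝. -/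
open MvPolynomial Finset

namespace LogStab

/-- The logarithmic derivative of a product of powers, with denominators cleared. -/
theorem prod_mul_derivation_prod_pow {R A ι : Type*} [CommRing R] [CommRing A] [Algebra R A]
    [DecidableEq ι] (D : Derivation R A A) (s : Finset ι) (G : ι → A) (e : ι → ℕ) :
    (∏ j ∈ s, G j) * D (∏ j ∈ s, G j ^ e j) =
      (∏ j ∈ s, G j ^ e j) * ∑ j ∈ s, (e j : A) * (∏ l ∈ s.erase j, G l) * D (G j) := by
  induction s using Finset.induction_on with
  | empty => simp
  | insert a s ha ih =>
    have hsum : ∑ j ∈ s, (e j : A) * (∏ l ∈ (insert a s).erase j, G l) * D (G j) =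
        G a * ∑ j ∈ s, (e j : A) * (∏ l ∈ s.erase j, G l) * D (G j) := by
      rw [Finset.mul_sum]
      refine Finset.sum_congr rfl fun j hj => ?_
      have haj : a ≠ j := fun h => ha (h ▸ hj)
      rw [Finset.erase_insert_of_ne haj,
        Finset.prod_insert fun h => ha (Finset.mem_of_mem_erase h)]
      ring
    have hpow : G a * D (G a ^ e a) = (e a : A) * G a ^ e a * D (G a) := by
      rw [D.leibniz_pow]
      cases e a with
      | zero => simp
      | succ k => simp only [Nat.add_sub_cancel, nsmul_eq_mul, smul_eq_mul]; ring
    rw [Finset.prod_insert ha, Finset.prod_insert ha, Finset.sum_insert ha,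
      Finset.erase_insert ha, hsum, D.leibniz, smul_eq_mul, smul_eq_mul]
    linear_combination (G a * G a ^ e a) * ih +
      ((∏ j ∈ s, G j) * ∏ j ∈ s, G j ^ e j) * hpow

/-- In characteristic zero, a nonzero homogeneous polynomial of positive degree does not divide
all of its partial derivatives. -/
theorem exists_not_dvd_pderiv_s6 {σ K : Type*} [Fintype σ] [Field K] [CharZero K]
    {G : MvPolynomial σ K} {d : ℕ} (hG : G.IsHomogeneous d) (hG0 : G ≠ 0) (hd : 1 ≤ d) :
    ∃ k, ¬ G ∣ pderiv k G := by
  by_contra! h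
  have hzero : ∀ k, pderiv k G = 0 := by
    intro k
    by_contra hk
    have hle := totalDegree_le_of_dvd_of_isDomain (h k) hk
    rw [hG.totalDegree hG0, (hG.pderiv (i := k)).totalDegree hk] at hle
    omega
  have heuler := hG.sum_X_mul_pderiv
  simp only [hzero, mul_zero, Finset.sum_const_zero] at heuler
  rcases smul_eq_zero.mp heuler.symm with h0 | h0
  · omega
  · exact hG0 h0

/-- If one irreducible polynomial over a field divides another, they are proportional. -/
theorem exists_eq_C_mul_of_irreducible_dvd {σ K : Type*} [Field K] {G H : MvPolynomial σ K}
    (hG : Irreducible G) (hH : Irreducible H) (h : G ∣ H) : ∃ t : K, H = C t * G := by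
  obtain ⟨u, hu⟩ := hG.associated_of_dvd hH h
  obtain ⟨t, -, ht⟩ := isUnit_iff_eq_C_of_isReduced.mp u.isUnit
  exact ⟨t, by rw [← hu, ht, mul_comm]⟩

/-- The logarithmic differentials of pairwise non-proportional irreducible homogeneous polynomials
are linearly independent over the constants. -/
theorem eq_zero_of_sum_log_pderiv_eq_zero {ι σ K : Type*} [Fintype ι] [DecidableEq ι] [Fintype σ]
    [Field K] [CharZero K] {G : ι → MvPolynomial σ K} {d : ι → ℕ} (s : ι → K)
    (hd : ∀ j, 1 ≤ d j) (hirr : ∀ j, Irreducible (G j)) (hhom : ∀ j, (G j).IsHomogeneous (d j))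
    (hprop : ∀ j k, j ≠ k → ∀ t : K, G j ≠ C t * G k)
    (hsum : ∀ k, ∑ j, C (s j) * (∏ l ∈ Finset.univ.erase j, G l) * pderiv k (G j) = 0) (j : ι) :
    s j = 0 := by
  by_contra hs
  obtain ⟨k, hk⟩ := exists_not_dvd_pderiv_s6 (hhom j) (hirr j).ne_zero (hd j)
  have hprime : Prime (G j) := (hirr j).prime
  have hdvd : G j ∣ C (s j) * (∏ l ∈ Finset.univ.erase j, G l) * pderiv k (G j) := by
    have hk0 := hsum k
    rw [← Finset.add_sum_erase _ _ (Finset.mem_univ j)] at hk0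
    rw [eq_neg_of_add_eq_zero_left hk0, dvd_neg]
    refine Finset.dvd_sum fun i hi => Dvd.dvd.mul_right (Dvd.dvd.mul_left ?_ _) _
    exact Finset.dvd_prod_of_mem G
      (Finset.mem_erase.mpr ⟨(Finset.ne_of_mem_erase hi).symm, Finset.mem_univ j⟩)
  rcases hprime.dvd_or_dvd hdvd with h | h
  · rcases hprime.dvd_or_dvd h with h | h
    · exact hprime.not_isUnit (isUnit_of_dvd_unit h ((isUnit_iff_ne_zero.mpr hs).map C))
    · obtain ⟨l, hl, hjl⟩ := hprime.exists_mem_finset_dvd h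
      obtain ⟨t, ht⟩ := exists_eq_C_mul_of_irreducible_dvd (hirr j) (hirr l) hjl
      exact hprop l j (Finset.ne_of_mem_erase hl) t ht
  · exact hk h

/-- Description of the base locus: if `λ ≠ 0`, the `Fᵢ` are nonzero homogeneous with
`μ(λ, F) = ∑ λᵢ F̂ᵢ dFᵢ = 0`, and `Fᵢ = cᵢ ∏ⱼ Gⱼ^{eᵢⱼ}` is the factorization of the `Fᵢ`
into pairwise non-proportional irreducible homogeneous `Gⱼ`, then `∑ᵢ λᵢ eᵢⱼ = 0` for
every `j`, and `dᵢ = ∑ⱼ eᵢⱼ d'ⱼ`. -/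
theorem statement6 (n m m' : ℕ) (dd : Fin m → ℕ) (dd' : Fin m' → ℕ)
    (lam : Fin m → ℂ) (F : Fin m → S (n+1))
    (c : Fin m → ℂ) (e : Fin m → Fin m' → ℕ) (G : Fin m' → S (n+1))
    (hlam : lam ≠ 0)
    (hd : ∀ i, 1 ≤ dd i) (hd' : ∀ j, 1 ≤ dd' j)
    (hF0 : ∀ i, F i ≠ 0) (hFh : ∀ i, (F i).IsHomogeneous (dd i))
    (hc : ∀ i, c i ≠ 0)
    (hGirr : ∀ j, Irreducible (G j)) (hGh : ∀ j, (G j).IsHomogeneous (dd' j))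
    (hGprop : ∀ j k, j ≠ k → ∀ t : ℂ, G j ≠ C t * G k)
    (hfact : ∀ i, F i = C (c i) * ∏ j, G j ^ e i j)
    (hzero : ∀ k, ∑ i, C (lam i) * Fhat F i * pderiv k (F i) = 0) :
    (∀ j, ∑ i, lam i * (e i j : ℂ) = 0) ∧ (∀ i, dd i = ∑ j, e i j * dd' j) := by
  refine ⟨?_, fun i => ?_⟩
  · refine eq_zero_of_sum_log_pderiv_eq_zero (fun j => ∑ i, lam i * (e i j : ℂ))
      hd' hGirr hGh hGprop fun k => ?_
    have hlog : ∀ i, (∏ j, G j) * pderiv k (F i) =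
        F i * ∑ j, (e i j : S (n+1)) * (∏ l ∈ Finset.univ.erase j, G l) * pderiv k (G j) := by
      intro i
      rw [hfact i, pderiv_C_mul]
      linear_combination C (c i) * prod_mul_derivation_prod_pow (pderiv k) Finset.univ G (e i)
    have hprod : ∏ i, F i ≠ 0 := Finset.prod_ne_zero_iff.mpr fun i _ => hF0 i
    refine (mul_eq_zero.mp ?_).resolve_left hprod
    calc (∏ i, F i) * ∑ j, C (∑ i, lam i * (e i j : ℂ)) *
            (∏ l ∈ Finset.univ.erase j, G l) * pderiv k (G j)
        = ∑ i, C (lam i) * (∏ i, F i) *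
            ∑ j, (e i j : S (n+1)) * (∏ l ∈ Finset.univ.erase j, G l) * pderiv k (G j) := by
          simp only [map_sum, map_mul, map_natCast, Finset.mul_sum, Finset.sum_mul]
          rw [Finset.sum_comm]
          exact Finset.sum_congr rfl fun i _ => Finset.sum_congr rfl fun j _ => by ring
      _ = (∏ j, G j) * ∑ i, C (lam i) * Fhat F i * pderiv k (F i) := by
          rw [Finset.mul_sum]
          refine Finset.sum_congr rfl fun i _ => ?_
          rw [← Finset.mul_prod_erase _ F (Finset.mem_univ i), Fhat]
          linear_combination -(C (lam i) * ∏ j ∈ Finset.univ.erase i, F j) * hlog i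
      _ = 0 := by rw [hzero k, mul_zero]
  · refine (hFh i).inj_right ?_ (hF0 i)
    rw [hfact i]
    refine IsHomogeneous.C_mul (IsHomogeneous.prod _ _ _ fun j _ => ?_) _
    rw [mul_comm]
    exact (hGh j).pow _

end LogStab
end

section
/- Let ω = Σ_i λ_i F̂_i dF_i be a logarithmic 1-form of type 𝐝, let λ' ∈ ℂ^m and F'_i homogeneous of degree d_i, and let α = Σ_i λ'_i F̂_i dF_i + Σ_{i≠k} λ_i F'_k F̂_{ik} dF_i + Σ_i λ_i F̂_i dF'_i (the derivative of μ at (λ, F) in direction (λ', F')). Set G = Σ_i F̂_i F'_i and H = Σ_i λ_i F̂_i F'_i. Then the following identity of polynomial 1-forms holds: F·α = F·(Σ_i λ'_i F̂_i dF_i) + G·ω + F·dH − H·dF. (Equivalently, after dividing by F², the rational form β = α/F equals η' + (G/F)η + d(H/F), where η = ω/F and η' = Σ_i λ'_i dF_i/F_i.) -/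
open MvPolynomial Finset

namespace LogStab

theorem prod_eq_mul_Fhat {N m : ℕ} (F : Fin m → S N) (i : Fin m) :
    ∏ j, F j = F i * Fhat F i :=
  (Finset.mul_prod_erase univ F (mem_univ i)).symm

theorem prod_mul_Fhat2 {N m : ℕ} (F : Fin m → S N) {i j : Fin m} (hij : j ≠ i) :
    (∏ l, F l) * Fhat2 F i j = Fhat F i * Fhat F j := by
  have hi : Fhat F i = F j * Fhat2 F i j :=
    (Finset.mul_prod_erase (univ.erase i) F (mem_erase.mpr ⟨hij, mem_univ j⟩)).symm
  rw [prod_eq_mul_Fhat F j, hi]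
  ring

theorem prod_mul_pderiv_Fhat {N m : ℕ} (F : Fin m → S N) (i : Fin m) (k : Fin N) :
    (∏ j, F j) * pderiv k (Fhat F i) =
      Fhat F i * (pderiv k (∏ j, F j) - Fhat F i * pderiv k (F i)) := by
  rw [prod_eq_mul_Fhat F i, pderiv_mul]
  ring

theorem prod_mul_sum_Fhat2 {N m : ℕ} (F F' : Fin m → S N) (i : Fin m) :
    (∏ j, F j) * ∑ j ∈ univ.erase i, F' j * Fhat2 F i j =
      Fhat F i * (∑ j, Fhat F j * F' j - Fhat F i * F' i) := by
  rw [← Finset.add_sum_erase univ (fun j => Fhat F j * F' j) (mem_univ i), add_sub_cancel_left,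
    Finset.mul_sum, Finset.mul_sum]
  refine Finset.sum_congr rfl fun j hj => ?_
  linear_combination F' j * prod_mul_Fhat2 F (ne_of_mem_erase hj)

/-- The derivative `α = dμ(λ,F)(λ',F')` satisfies the identity
`F·α = F·(∑ λ'ᵢ F̂ᵢ dFᵢ) + G·ω + F·dH - H·dF`, where `G = ∑ F̂ᵢ F'ᵢ` and
`H = ∑ λᵢ F̂ᵢ F'ᵢ` (equivalently `β = α/F = η' + (G/F)η + d(H/F)`). -/
theorem statement9 (n m : ℕ) (dd : Fin m → ℕ) (lam lam' : Fin m → ℂ)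
    (F F' : Fin m → S (n+1))
    (hd : ∀ i, 1 ≤ dd i)
    (hFh : ∀ i, (F i).IsHomogeneous (dd i)) (hF'h : ∀ i, (F' i).IsHomogeneous (dd i)) :
    ∀ k, (∏ j, F j) * dmu lam F lam' F' k =
      (∏ j, F j) * (∑ i, C (lam' i) * Fhat F i * pderiv k (F i))
      + (∑ i, Fhat F i * F' i) * logForm lam F k
      + (∏ j, F j) * pderiv k (∑ i, C (lam i) * Fhat F i * F' i)
      - (∑ i, C (lam i) * Fhat F i * F' i) * pderiv k (∏ j, F j) := by
  intro k
  have hmixed : ∀ i, ∑ j ∈ univ.erase i, C (lam i) * F' j * Fhat2 F i j * pderiv k (F i) =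
      C (lam i) * pderiv k (F i) * ∑ j ∈ univ.erase i, F' j * Fhat2 F i j := fun i => by
    rw [Finset.mul_sum]
    exact Finset.sum_congr rfl fun j _ => by ring
  simp only [dmu, logForm, hmixed, map_sum, pderiv_mul, pderiv_C]
  rw [mul_add, mul_add, add_assoc, add_assoc, add_sub_assoc, add_right_inj]
  generalize hG : ∑ i, Fhat F i * F' i = G
  simp only [Finset.mul_sum (s := univ), Finset.sum_mul]
  rw [add_sub_assoc, ← Finset.sum_add_distrib, ← Finset.sum_sub_distrib,
    ← Finset.sum_add_distrib]
  refine Finset.sum_congr rfl fun i _ => ?_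
  have hsum := prod_mul_sum_Fhat2 F F' i
  rw [hG] at hsum
  linear_combination C (lam i) * pderiv k (F i) * hsum -
    C (lam i) * F' i * prod_mul_pderiv_Fhat F i k

end LogStab
end

section
/- Let ω and α be projective homogeneous polynomial 1-forms of the same degree d on ℂ^{n+1}, with ω integrable (ω ∧ dω = 0). Then ω ∧ dα + α ∧ dω = 0 if and only if dω ∧ dα = 0. -/
open MvPolynomial Finset

namespace LogStab

/-- Partial derivatives commute. -/
lemma pderiv_comm {N : ℕ} (i j : Fin N) (p : S N) :
    pderiv i (pderiv j p) = pderiv j (pderiv i p) := by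
  have h : ⁅(pderiv i : Derivation ℂ (S N) (S N)),
      (pderiv j : Derivation ℂ (S N) (S N))⁆ = 0 := by
    refine MvPolynomial.derivation_ext fun k => ?_
    simp [Derivation.commutator_apply, pderiv_X, Pi.single_apply, apply_ite]
  have := congrArg (fun D => D p) h
  simpa [Derivation.commutator_apply, sub_eq_zero] using this

/-- Contracting `dω` with the radial field, for `ω` projective with coefficients homogeneous of
degree `e`, gives `(e + 1) ω`. -/
lemma radial_extD {N e : ℕ} {ω : Form1 N} (hω : ∀ k, (ω k).IsHomogeneous e)
    (hp : radial ω = 0) (j : Fin N) :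
    ∑ i, X i * extD ω i j = (e + 1 : S N) * ω j := by
  have hd : ∑ i, (X i * pderiv j (ω i) + ω i * pderiv j (X i)) = 0 := by
    have h := congrArg (pderiv j) hp
    simpa [radial, Derivation.leibniz] using h
  have hs : ∑ i, ω i * pderiv j (X i : S N) = ω j := by
    simp [pderiv_X, Pi.single_apply]
  have he := (hω j).sum_X_mul_pderiv
  rw [Finset.sum_add_distrib, hs] at hd
  rw [nsmul_eq_mul] at he
  simp only [extD, mul_sub, Finset.sum_sub_distrib]
  linear_combination he - hd

/-- The exterior derivative of `ω ∧ dα + α ∧ dω` is `2 dω ∧ dα`. -/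
lemma extD_tangent {N : ℕ} (ω α : Form1 N) (i j k l : Fin N) :
    let T := fun a b c => w12 ω (extD α) a b c + w12 α (extD ω) a b c
    pderiv i (T j k l) - pderiv j (T i k l) + pderiv k (T i j l) - pderiv l (T i j k) =
      2 * w22 (extD ω) (extD α) i j k l := by
  simp only [w12, w22, extD, map_add, map_sub, Derivation.leibniz, smul_eq_mul,
    pderiv_comm j i, pderiv_comm k i, pderiv_comm l i, pderiv_comm k j, pderiv_comm l j,
    pderiv_comm l k]
  ring

/-- Contracting `dω ∧ dα` with the radial field gives `(e + 1) (ω ∧ dα + α ∧ dω)`. -/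
lemma radial_w22 {N e : ℕ} {ω α : Form1 N}
    (hω : ∀ k, (ω k).IsHomogeneous e) (hα : ∀ k, (α k).IsHomogeneous e)
    (hωp : radial ω = 0) (hαp : radial α = 0) (j k l : Fin N) :
    ∑ i, X i * w22 (extD ω) (extD α) i j k l =
      (e + 1 : S N) * (w12 ω (extD α) j k l + w12 α (extD ω) j k l) := by
  have hexp : ∑ i, X i * w22 (extD ω) (extD α) i j k l =
      (∑ i, X i * extD ω i j) * extD α k l - (∑ i, X i * extD ω i k) * extD α j l
      + (∑ i, X i * extD ω i l) * extD α j k + (∑ i, X i * extD α i l) * extD ω j k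
      - (∑ i, X i * extD α i k) * extD ω j l + (∑ i, X i * extD α i j) * extD ω k l := by
    simp only [Finset.sum_mul, ← Finset.sum_add_distrib, ← Finset.sum_sub_distrib]
    refine Finset.sum_congr rfl fun i _ => ?_
    simp only [w22]
    ring
  rw [hexp]
  simp only [radial_extD hω hωp, radial_extD hα hαp, w12]
  ring

/-- For projective homogeneous 1-forms `ω, α` of the same degree `d` with `ω` integrable,
`ω ∧ dα + α ∧ dω = 0` iff `dω ∧ dα = 0`. -/
theorem statement14 (n d : ℕ) (ω α : Form1 (n+1))
    (hωh : IsHomog1 ω d) (hαh : IsHomog1 α d)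
    (hωp : radial ω = 0) (hαp : radial α = 0)
    (hint : ∀ i j k, w12 ω (extD ω) i j k = 0) :
    TangentZero ω α ↔ (∀ i j k l, w22 (extD ω) (extD α) i j k l = 0) := by
  constructor
  · intro h i j k l
    have hd := extD_tangent ω α i j k l
    simp only [h _ _ _, map_zero, sub_zero, add_zero] at hd
    exact (mul_eq_zero.mp hd.symm).resolve_left two_ne_zero
  · intro h i j k
    have hr := radial_w22 hωh hαh hωp hαp i j k
    simp only [h, mul_zero, Finset.sum_const_zero] at hr
    exact (mul_eq_zero.mp hr.symm).resolve_left (Nat.cast_add_one_ne_zero _)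

end LogStab
end

section
/- Let ω = Σ_i λ_i F̂_i dF_i be a logarithmic 1-form of type 𝐝 with the λ_i pairwise distinct, Σ_i d_i λ_i = 0, and the F_i in general position (smooth irreducible components with simple normal crossings). Let α be a projective homogeneous polynomial 1-form of degree d with ω ∧ dα + α ∧ dω = 0. Then α vanishes on X^{(3)}: for every nonzero x ∈ ℂ^{n+1} with F_i(x) = F_j(x) = F_k(x) = 0 for three distinct indices i, j, k, all coefficients of α vanish at x. -/
open MvPolynomial Finset

namespace LogStab

/-- A linearly independent finite family of linear forms takes prescribed values at some vector. -/
lemma exists_dot_eq {ι : Type*} [Fintype ι] {N : ℕ} {A : ι → Fin N → ℂ}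
    (hA : LinearIndependent ℂ A) (c : ι → ℂ) :
    ∃ v : Fin N → ℂ, ∀ i, ∑ p, A i p * v p = c i := by
  classical
  have hinj : LinearMap.ker (Fintype.linearCombination ℂ A) = ⊥ :=
    LinearMap.ker_eq_bot'.2 fun c hc =>
      funext (Fintype.linearIndependent_iff.1 hA c (by simpa [Fintype.linearCombination] using hc))
  obtain ⟨g, hg⟩ := LinearMap.exists_leftInverse_of_injective _ hinj
  have hgA (i : ι) : g (A i) = Pi.single i 1 := by
    have := LinearMap.congr_fun hg (Pi.single i 1)
    simpa [Fintype.linearCombination_apply_single] using this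
  refine ⟨fun p => ∑ j, c j * g (Pi.single p 1) j, fun i => ?_⟩
  have hsum : ∑ p, A i p • g (Pi.single p 1) = Pi.single i 1 := by
    rw [← hgA i]
    conv_rhs => rw [pi_eq_sum_univ' (A i)]
    rw [map_sum]
    refine Finset.sum_congr rfl fun p _ => ?_
    rw [map_smul]
  calc ∑ p, A i p * ∑ j, c j * g (Pi.single p 1) j
      = ∑ j, c j * (∑ p, A i p • g (Pi.single p 1)) j := by
        simp only [Finset.mul_sum, Finset.sum_apply, Pi.smul_apply, smul_eq_mul]
        rw [Finset.sum_comm]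
        exact Finset.sum_congr rfl fun j _ => Finset.sum_congr rfl fun p _ => by ring
    _ = c i := by
        rw [hsum]
        simp [Pi.single_apply]

/-- Restriction of polynomials to the parametrized line `t ↦ x + t v`. -/
noncomputable def lineHom {N : ℕ} (x v : Fin N → ℂ) : S N →ₐ[ℂ] Polynomial ℂ :=
  aeval fun p => Polynomial.C (x p) + Polynomial.C (v p) * Polynomial.X

lemma eval_zero_lineHom {N : ℕ} (x v : Fin N → ℂ) (f : S N) :
    (lineHom x v f).eval 0 = eval x f := by
  induction f using MvPolynomial.induction_on with
  | C a => simp [lineHom]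
  | add p q hp hq => simp [hp, hq]
  | mul_X p i hp => simp [hp]; simp [lineHom]

lemma derivative_lineHom {N : ℕ} (x v : Fin N → ℂ) (f : S N) :
    Polynomial.derivative (lineHom x v f) =
      ∑ p, lineHom x v (pderiv p f) * Polynomial.C (v p) := by
  induction f using MvPolynomial.induction_on with
  | C a => simp [lineHom]
  | add f g hf hg => simp [hf, hg, add_mul, Finset.sum_add_distrib]
  | mul_X f i hf =>
    have hX : Polynomial.derivative (lineHom x v (X i)) = Polynomial.C (v i) := by
      simp [lineHom]
    have hterm (p : Fin N) : lineHom x v (pderiv p (f * X i)) * Polynomial.C (v p) =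
        lineHom x v (pderiv p f) * Polynomial.C (v p) * lineHom x v (X i) +
          if p = i then lineHom x v f * Polynomial.C (v p) else 0 := by
      rw [pderiv_mul, map_add, map_mul, map_mul]
      split_ifs with h
      · rw [h, pderiv_X_self, map_one]
        ring
      · rw [pderiv_X_of_ne (Ne.symm h), map_zero]
        ring
    simp only [hterm, Finset.sum_add_distrib, ← Finset.sum_mul, ← hf, Finset.sum_ite_eq',
      Finset.mem_univ, if_true]
    rw [map_mul, Polynomial.derivative_mul, hX]

lemma coeff_one_lineHom {N : ℕ} (x v : Fin N → ℂ) (f : S N) :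
    (lineHom x v f).coeff 1 = ∑ p, eval x (pderiv p f) * v p := by
  have h := Polynomial.coeff_derivative (lineHom x v f) 0
  rw [derivative_lineHom, Polynomial.coeff_zero_eq_eval_zero, Polynomial.eval_finsetSum] at h
  simpa [eval_zero_lineHom] using h.symm

lemma pderiv_prod {N : ℕ} {ι : Type*} [DecidableEq ι] (k : Fin N) (s : Finset ι) (f : ι → S N) :
    pderiv k (∏ i ∈ s, f i) = ∑ i ∈ s, (∏ j ∈ s.erase i, f j) * pderiv k (f i) := by
  induction s using Finset.induction_on with
  | empty => simp
  | insert a s ha ih =>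
    rw [Finset.prod_insert ha, pderiv_mul, ih, Finset.sum_insert ha, Finset.erase_insert ha,
      Finset.mul_sum, mul_comm]
    congr 1
    refine Finset.sum_congr rfl fun i hi => ?_
    have hai : a ≠ i := fun h => ha (h ▸ hi)
    rw [Finset.erase_insert_of_ne hai, Finset.prod_insert (by simp [ha]), mul_assoc]

lemma pderiv_comm_s15 {N : ℕ} (k l : Fin N) (f : S N) :
    pderiv k (pderiv l f) = pderiv l (pderiv k f) := by
  have h : ⁅(pderiv k : Derivation ℂ (S N) (S N)), pderiv l⁆ = 0 :=
    derivation_ext fun i => by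
      rw [Derivation.commutator_apply, pderiv_X, pderiv_X, Pi.single_apply, Pi.single_apply]
      split_ifs <;> simp
  rw [← sub_eq_zero, ← Derivation.commutator_apply, h, Derivation.zero_apply]

lemma extD_logForm {N m : ℕ} (lam : Fin m → ℂ) (F : Fin m → S N) (k l : Fin N) :
    extD (logForm lam F) k l =
      ∑ i, ∑ j ∈ Finset.univ.erase i,
        C (lam i) * Fhat2 F i j * w11 (Dp (F j)) (Dp (F i)) k l := by
  have hder (k : Fin N) (i : Fin m) :
      pderiv k (Fhat F i) = ∑ j ∈ Finset.univ.erase i, Fhat2 F i j * pderiv k (F j) :=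
    pderiv_prod k _ F
  have hcomm (i : Fin m) : pderiv k (pderiv l (F i)) = pderiv l (pderiv k (F i)) :=
    pderiv_comm_s15 k l (F i)
  simp only [extD, logForm, map_sum, ← Finset.sum_sub_distrib]
  refine Finset.sum_congr rfl fun i _ => ?_
  have : ∑ j ∈ Finset.univ.erase i, C (lam i) * Fhat2 F i j * w11 (Dp (F j)) (Dp (F i)) k l =
      C (lam i) * (pderiv k (Fhat F i) * pderiv l (F i) -
        pderiv l (Fhat F i) * pderiv k (F i)) := by
    simp only [hder, Finset.sum_mul, ← Finset.sum_sub_distrib, Finset.mul_sum, w11, Dp]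
    exact Finset.sum_congr rfl fun j _ => by ring
  rw [this]
  simp only [Derivation.leibniz, smul_eq_mul, pderiv_C, hcomm]
  ring

/-- Under a ring homomorphism killing every `F̂ᵢ`, and every `F̂ᵢⱼ` except `F̂_{ab}`, the
equation `ω ∧ dα + α ∧ dω = 0` reduces to `(λ_b - λ_a) F̂_{ab} α ∧ dF_a ∧ dF_b = 0`. -/
lemma map_eq_zero_of_tangentZero {N m : ℕ} {R : Type*} [CommRing R] (ψ : S N →+* R)
    {lam : Fin m → ℂ} {F : Fin m → S N} {α : Form1 N} (ht : TangentZero (logForm lam F) α)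
    {a b : Fin m} (hab : a ≠ b) (h1 : ∀ i, ψ (Fhat F i) = 0)
    (h2 : ∀ i j, i ≠ j → ¬ (i = a ∧ j = b) → ¬ (i = b ∧ j = a) → ψ (Fhat2 F i j) = 0)
    (p q r : Fin N) :
    ψ (C (lam b - lam a) * Fhat2 F a b * w12 α (w11 (Dp (F a)) (Dp (F b))) p q r) = 0 := by
  have hω (k : Fin N) : ψ (logForm lam F k) = 0 := by
    simp [logForm, h1]
  have hsymm : Fhat2 F b a = Fhat2 F a b := by
    simp only [Fhat2, Finset.erase_right_comm]
  have hdω (k l : Fin N) : ψ (extD (logForm lam F) k l) =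
      ψ (C (lam b - lam a) * Fhat2 F a b * w11 (Dp (F a)) (Dp (F b)) k l) := by
    simp only [extD_logForm, map_sum]
    rw [Finset.sum_eq_add a b hab]
    · rw [Finset.sum_eq_single b, Finset.sum_eq_single a, hsymm, ← map_add]
      · congr 1
        simp only [w11, map_sub]
        ring
      · intro j hj hja
        rw [map_mul, map_mul, h2 b j (Finset.ne_of_mem_erase hj).symm (by tauto) (by tauto)]
        simp
      · simp [hab]
      · intro j hj hjb
        rw [map_mul, map_mul, h2 a j (Finset.ne_of_mem_erase hj).symm (by tauto) (by tauto)]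
        simp
      · simp [hab.symm]
    · intro i _ hi
      refine Finset.sum_eq_zero fun j hj => ?_
      rw [map_mul, map_mul, h2 i j (Finset.ne_of_mem_erase hj).symm (by tauto) (by tauto)]
      simp
    · simp
    · simp
  have h := congrArg ψ (ht p q r)
  simp only [w12, map_add, map_sub, map_mul, map_zero, hω, hdω, zero_mul, sub_zero,
    zero_add] at h ⊢
  linear_combination h

/-- If `α ∧ A ∧ B = 0` and `A`, `B` take the values of the dual basis on `u`, `v`, then `α` is
a combination of `A` and `B`. -/
lemma eq_of_wedge_eq_zero {N : ℕ} {α A B u v : Fin N → ℂ}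
    (h : ∀ p q r, α p * (A q * B r - A r * B q) - α q * (A p * B r - A r * B p) +
      α r * (A p * B q - A q * B p) = 0)
    (hAu : ∑ p, A p * u p = 1) (hBu : ∑ p, B p * u p = 0)
    (hAv : ∑ p, A p * v p = 0) (hBv : ∑ p, B p * v p = 1) (p : Fin N) :
    α p = (∑ q, α q * u q) * A p + (∑ q, α q * v q) * B p := by
  have hr (q : Fin N) : α p * A q - α q * A p + (∑ r, α r * v r) * (A p * B q - A q * B p) = 0 := by
    have : ∑ r, (α p * (A q * B r - A r * B q) - α q * (A p * B r - A r * B p) +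
      α r * (A p * B q - A q * B p)) * v r = 0 := Finset.sum_eq_zero fun r _ => by rw [h]; ring
    have hsplit : ∑ r, (α p * (A q * B r - A r * B q) - α q * (A p * B r - A r * B p) +
        α r * (A p * B q - A q * B p)) * v r =
        (α p * A q - α q * A p) * ∑ r, B r * v r + (α q * B p - α p * B q) * ∑ r, A r * v r +
        (A p * B q - A q * B p) * ∑ r, α r * v r := by
      simp only [Finset.mul_sum, ← Finset.sum_add_distrib]
      exact Finset.sum_congr rfl fun r _ => by ring
    rw [hsplit, hAv, hBv] at this
    linear_combination this
  have : ∑ q, (α p * A q - α q * A p + (∑ r, α r * v r) * (A p * B q - A q * B p)) * u q = 0 :=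
    Finset.sum_eq_zero fun q _ => by rw [hr]; ring
  have hsplit :
      ∑ q, (α p * A q - α q * A p + (∑ r, α r * v r) * (A p * B q - A q * B p)) * u q =
      (α p - (∑ r, α r * v r) * B p) * ∑ q, A q * u q - A p * ∑ q, α q * u q +
        (∑ r, α r * v r) * A p * ∑ q, B q * u q := by
    generalize ∑ r, α r * v r = s
    simp only [Finset.mul_sum, ← Finset.sum_add_distrib, ← Finset.sum_sub_distrib]
    exact Finset.sum_congr rfl fun r _ => by ring
  rw [hsplit, hAu, hBu] at this
  linear_combination this

/-- At a nonzero point where `F_a` and `F_b` vanish, `α ∧ dF_a ∧ dF_b = 0`. -/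
lemma eval_wedge_eq_zero {N m : ℕ} {lam : Fin m → ℂ} {F : Fin m → S N} {α : Form1 N}
    (hgen : GeneralPosition F) (ht : TangentZero (logForm lam F) α)
    {x : Fin N → ℂ} (hx : x ≠ 0) {a b : Fin m} (hab : a ≠ b) (hlam : lam a ≠ lam b)
    (ha : eval x (F a) = 0) (hb : eval x (F b) = 0) (p q r : Fin N) :
    eval x (w12 α (w11 (Dp (F a)) (Dp (F b))) p q r) = 0 := by
  classical
  obtain ⟨v, hv⟩ := exists_dot_eq (hgen.2 x hx) fun i => if i.1 = a ∨ i.1 = b then 0 else 1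
  set φ := lineHom x v
  -- `w i` bounds from below the vanishing order at `0` of `F i` along the line, with equality
  -- away from `a` and `b`
  let w : Fin m → ℕ := fun i => if i = a ∨ i = b then 2 else if eval x (F i) = 0 then 1 else 0
  have hφ0 (i : Fin m) : (φ (F i)).coeff 0 = eval x (F i) := by
    rw [Polynomial.coeff_zero_eq_eval_zero, eval_zero_lineHom]
  have hφ1 (i : Fin m) (hi : eval x (F i) = 0) :
      (φ (F i)).coeff 1 = if i = a ∨ i = b then 0 else 1 := by
    rw [coeff_one_lineHom]
    exact hv ⟨i, hi⟩
  have hdvd (i : Fin m) : ∃ G, φ (F i) = Polynomial.X ^ w i * G ∧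
      (i ≠ a → i ≠ b → G.eval 0 ≠ 0) := by
    by_cases hi : i = a ∨ i = b
    · have hi0 : eval x (F i) = 0 := by rcases hi with rfl | rfl <;> assumption
      have h2 : Polynomial.X ^ 2 ∣ φ (F i) := by
        rw [Polynomial.X_pow_dvd_iff]
        intro e he
        interval_cases e
        · rw [hφ0, hi0]
        · rw [hφ1 i hi0, if_pos hi]
      obtain ⟨G, hG⟩ := h2
      exact ⟨G, by simpa [w, hi] using hG, by tauto⟩
    · by_cases hi0 : eval x (F i) = 0
      · have h1 : Polynomial.X ∣ φ (F i) := Polynomial.X_dvd_iff.2 (by rw [hφ0, hi0])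
        obtain ⟨G, hG⟩ := h1
        refine ⟨G, by simpa [w, hi, hi0] using hG, fun _ _ => ?_⟩
        have := hφ1 i hi0
        rw [if_neg hi, hG, Polynomial.coeff_X_mul, Polynomial.coeff_zero_eq_eval_zero] at this
        simp [this]
      · refine ⟨φ (F i), by simp [w, hi, hi0], fun _ _ => ?_⟩
        rwa [eval_zero_lineHom]
  choose G hG hG0 using hdvd
  have hprod (s : Finset (Fin m)) :
      φ (∏ i ∈ s, F i) = Polynomial.X ^ (∑ i ∈ s, w i) * ∏ i ∈ s, G i := by
    rw [map_prod, ← Finset.prod_pow_eq_pow_sum, ← Finset.prod_mul_distrib]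
    exact Finset.prod_congr rfl fun i _ => hG i
  have hsum1 (i : Fin m) : w i + ∑ j ∈ univ.erase i, w j = ∑ j, w j :=
    Finset.add_sum_erase _ _ (Finset.mem_univ i)
  have hsum2 (i j : Fin m) (hij : i ≠ j) :
      w j + ∑ k ∈ (univ.erase i).erase j, w k = ∑ k ∈ univ.erase i, w k :=
    Finset.add_sum_erase _ _ (by simp [hij.symm])
  set e := ∑ k ∈ (univ.erase a).erase b, w k
  have hwa : w a = 2 := by simp [w]
  have hwb : w b = 2 := by simp [w]
  have hw2 (i : Fin m) : w i ≤ 2 := by simp only [w]; split_ifs <;> omega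
  have hw1 (i : Fin m) (hia : i ≠ a) (hib : i ≠ b) : w i ≤ 1 := by
    simp only [w, hia, hib]; split_ifs <;> simp_all
  have hea := hsum1 a
  have heb := hsum2 a b hab
  let π := Ideal.Quotient.mk (Ideal.span {(Polynomial.X ^ (e + 1) : Polynomial ℂ)})
  have hπ (f : Polynomial ℂ) : π f = 0 ↔ Polynomial.X ^ (e + 1) ∣ f := by
    rw [Ideal.Quotient.eq_zero_iff_mem, Ideal.mem_span_singleton]
  have key := map_eq_zero_of_tangentZero (π.comp (φ : S N →+* Polynomial ℂ)) ht hab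
    (fun i => by
      have := hsum1 i
      have := hw2 i
      refine (hπ _).2 ?_
      exact (hprod _) ▸ (pow_dvd_pow _ (by omega)).mul_right _)
    (fun i j hij h1 h2 => by
      have := hsum1 i
      have := hsum2 i j hij
      have hwij : w i + w j ≤ 3 := by
        have := hw2 i
        have := hw2 j
        by_cases hi : i = a ∨ i = b
        · have := hw1 j (by grind) (by grind)
          omega
        · have := hw1 i (by tauto) (by tauto)
          omega
      refine (hπ _).2 ?_
      exact (hprod _) ▸ (pow_dvd_pow _ (by omega)).mul_right _) p q r
  have key' := (hπ _).1 key
  set f := w12 α (w11 (Dp (F a)) (Dp (F b))) p q r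
  have hC : φ (C (lam b - lam a)) = Polynomial.C (lam b - lam a) := by
    simp [φ, lineHom]
  have hfac : φ (C (lam b - lam a) * Fhat2 F a b * f) = Polynomial.X ^ e *
      (Polynomial.C (lam b - lam a) * (∏ k ∈ (univ.erase a).erase b, G k) * φ f) := by
    rw [map_mul, map_mul, hC, Fhat2, hprod]
    ring
  have hX : Polynomial.X ∣
      Polynomial.C (lam b - lam a) * (∏ k ∈ (univ.erase a).erase b, G k) * φ f := by
    refine (mul_dvd_mul_iff_left (pow_ne_zero e Polynomial.X_ne_zero)).1 ?_
    rw [← hfac, ← pow_succ]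
    exact key'
  rw [Polynomial.X_dvd_iff, Polynomial.coeff_zero_eq_eval_zero, Polynomial.eval_mul,
    Polynomial.eval_mul, Polynomial.eval_C, eval_zero_lineHom, Polynomial.eval_prod] at hX
  refine (mul_eq_zero.1 hX).resolve_left (mul_ne_zero (sub_ne_zero.2 hlam.symm) ?_)
  refine Finset.prod_ne_zero_iff.2 fun k hk => ?_
  simp only [Finset.mem_erase, Finset.mem_univ, and_true] at hk
  exact hG0 k hk.2 hk.1

/-- If `ω = ∑ λᵢ F̂ᵢ dFᵢ` is logarithmic with pairwise distinct residues and `F` in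
general position, then any projective homogeneous 1-form `α` of degree `d` with
`ω ∧ dα + α ∧ dω = 0` vanishes on the stratum `X⁽³⁾`. -/
theorem statement15 (n m d : ℕ) (dd : Fin m → ℕ) (lam : Fin m → ℂ)
    (F : Fin m → S (n+1))
    (hd : ∀ i, 1 ≤ dd i) (hsum : ∑ i, dd i = d)
    (hFh : ∀ i, (F i).IsHomogeneous (dd i)) (hgen : GeneralPosition F)
    (hlam : ∀ i j, i ≠ j → lam i ≠ lam j)
    (hlamd : ∑ i, (dd i : ℂ) * lam i = 0)
    (α : Form1 (n+1)) (hαh : IsHomog1 α d) (hαp : radial α = 0)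
    (ht : TangentZero (logForm lam F) α) :
    ∀ x : Fin (n+1) → ℂ, x ≠ 0 →
      ∀ i j k : Fin m, i ≠ j → i ≠ k → j ≠ k →
        eval x (F i) = 0 → eval x (F j) = 0 → eval x (F k) = 0 →
        ∀ l, eval x (α l) = 0 := by
  classical
  intro x hx i j k hij hik hjk hi hj hk l
  choose v hv using fun a : {a : Fin m // eval x (F a) = 0} =>
    exists_dot_eq (hgen.2 x hx) (Pi.single a 1)
  have hcomb (a b : {a : Fin m // eval x (F a) = 0}) (hab : a ≠ b) (p : Fin (n+1)) :
      eval x (α p) = (∑ q, eval x (α q) * v a q) * eval x (pderiv p (F a)) +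
        (∑ q, eval x (α q) * v b q) * eval x (pderiv p (F b)) := by
    have hab' : a.1 ≠ b.1 := fun h => hab (Subtype.ext h)
    refine eq_of_wedge_eq_zero (α := fun p => eval x (α p)) (fun p q r => ?_)
      (by simpa using hv a a) (by simpa [hab.symm] using hv a b) (by simpa [hab] using hv b a)
      (by simpa using hv b b) p
    simpa [w12, w11, Dp] using
      eval_wedge_eq_zero hgen ht hx hab' (hlam _ _ hab') a.2 b.2 p q r
  have hzero (a b c : {a : Fin m // eval x (F a) = 0}) (hab : a ≠ b) (hac : a ≠ c)
      (hbc : b ≠ c) : ∑ q, eval x (α q) * v c q = 0 := by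
    have ha : ∑ p, eval x (pderiv p (F a)) * v c p = 0 := by simpa [hac] using hv c a
    have hb : ∑ p, eval x (pderiv p (F b)) * v c p = 0 := by simpa [hbc] using hv c b
    calc ∑ q, eval x (α q) * v c q
        = (∑ q, eval x (α q) * v a q) * ∑ p, eval x (pderiv p (F a)) * v c p +
          (∑ q, eval x (α q) * v b q) * ∑ p, eval x (pderiv p (F b)) * v c p := by
          rw [Finset.mul_sum, Finset.mul_sum, ← Finset.sum_add_distrib]
          refine Finset.sum_congr rfl fun p _ => ?_
          rw [hcomb a b hab p]
          ring
      _ = 0 := by rw [ha, hb]; ring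
  have hij' : (⟨i, hi⟩ : {a : Fin m // eval x (F a) = 0}) ≠ ⟨j, hj⟩ := by simpa using hij
  have hik' : (⟨i, hi⟩ : {a : Fin m // eval x (F a) = 0}) ≠ ⟨k, hk⟩ := by simpa using hik
  have hjk' : (⟨j, hj⟩ : {a : Fin m // eval x (F a) = 0}) ≠ ⟨k, hk⟩ := by simpa using hjk
  rw [hcomb _ _ hij' l, hzero _ _ _ hjk' hij'.symm hik'.symm, hzero _ _ _ hik' hij' hjk'.symm]
  ring

end LogStab
end
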